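/- One-dimensional differential inequality for negative and large powers: let d = 1 and let (u,m) be a smooth solution of the first-order planning system with m > 0 on [0,T]×𝕋. Then for every real s with s ≤ 0 or s ≥ 1, the function f(t) = ∫_𝕋 m(t,x)^s dx satisfies f''(t) ≥ −|s−1| ‖ΔV‖_{L^∞([0,T]×𝕋)} f(t) for all t ∈ (0,T). -/

import Mathlib

open MeasureTheory Real Set

/-- The `L^∞` norm of `ΔV = V_xx` on `[0,T] × 𝕋`. -/
noncomputable def lapVsup1 (T : ℝ) (V : ℝ → ℝ → ℝ) : ℝ :=
  sSup {y : ℝ | ∃ t ∈ Set.Icc (0 : ℝ) T, ∃ x : ℝ, y = |deriv (deriv (V t)) x|}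

def Sm (A : Set ℝ) (F : ℝ → ℝ → ℝ) : Prop :=
  ContDiffOn ℝ (⊤ : ℕ∞) (fun q : ℝ × ℝ => F q.1 q.2) (A ×ˢ (Set.univ : Set ℝ))

theorem Sm.hasX {A : Set ℝ} {F : ℝ → ℝ → ℝ} (h : Sm A F) {t : ℝ} (ht : t ∈ A) (x : ℝ) :
    HasDerivAt (F t) (fderivWithin ℝ (fun q : ℝ × ℝ => F q.1 q.2) (A ×ˢ (Set.univ : Set ℝ))
      (t, x) (0, 1)) x := by
  have h1 := ((h.differentiableOn (by simp)) (t, x) ⟨ht, mem_univ _⟩).hasFDerivWithinAt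
  have h2 : HasDerivWithinAt (fun y : ℝ => ((t, y) : ℝ × ℝ)) (0, 1) univ x :=
    ((hasDerivAt_const x t).prodMk (hasDerivAt_id x)).hasDerivWithinAt
  have h3 := h1.comp_hasDerivWithinAt x h2 (fun y _ => ⟨ht, mem_univ _⟩)
  simpa [Function.comp_def] using h3

theorem Sm.dx {A : Set ℝ} (hA : UniqueDiffOn ℝ A) {F : ℝ → ℝ → ℝ} (h : Sm A F) :
    Sm A (fun t x => deriv (F t) x) := by
  have h1 : ContDiffOn ℝ (⊤ : ℕ∞) _ _ :=
    ContDiffOn.fderivWithin (m := (⊤ : ℕ∞)) h (hA.prod uniqueDiffOn_univ) (by simp)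
  refine (h1.clm_apply (contDiffOn_const (c := ((0, 1) : ℝ × ℝ)))).congr ?_
  rintro ⟨t, x⟩ ⟨ht, -⟩
  exact (h.hasX ht x).deriv

theorem Sm.diffX {A : Set ℝ} {F : ℝ → ℝ → ℝ} (h : Sm A F) {t : ℝ} (ht : t ∈ A) (x : ℝ) :
    HasDerivAt (F t) (deriv (F t) x) x := (h.hasX ht x).differentiableAt.hasDerivAt

theorem Sm.contX {A : Set ℝ} {F : ℝ → ℝ → ℝ} (h : Sm A F) {t : ℝ} (ht : t ∈ A) :
    Continuous (F t) :=
  continuous_iff_continuousAt.2 fun x => (h.hasX ht x).continuousAt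

theorem Sm.at {A : Set ℝ} (hA : IsOpen A) {F : ℝ → ℝ → ℝ} (h : Sm A F) {t : ℝ} (ht : t ∈ A)
    (x : ℝ) : ContDiffAt ℝ (⊤ : ℕ∞) (fun q : ℝ × ℝ => F q.1 q.2) (t, x) :=
  h.contDiffAt ((hA.prod isOpen_univ).mem_nhds ⟨ht, mem_univ _⟩)

theorem Sm.hasX' {A : Set ℝ} (hA : IsOpen A) {F : ℝ → ℝ → ℝ} (h : Sm A F) {t : ℝ} (ht : t ∈ A)
    (x : ℝ) : HasDerivAt (F t) (fderiv ℝ (fun q : ℝ × ℝ => F q.1 q.2) (t, x) (0, 1)) x := by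
  have := h.hasX ht x
  rwa [fderivWithin_of_isOpen (hA.prod isOpen_univ) ⟨ht, mem_univ _⟩] at this

theorem Sm.hasT {A : Set ℝ} (hA : IsOpen A) {F : ℝ → ℝ → ℝ} (h : Sm A F) {t : ℝ} (ht : t ∈ A)
    (x : ℝ) : HasDerivAt (fun r => F r x)
      (fderiv ℝ (fun q : ℝ × ℝ => F q.1 q.2) (t, x) (1, 0)) t := by
  have h1 := ((h.at hA ht x).differentiableAt (by simp)).hasFDerivAt
  have h2 : HasDerivAt (fun y : ℝ => ((y, x) : ℝ × ℝ)) (1, 0) t :=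
    ((hasDerivAt_id t).prodMk (hasDerivAt_const t x))
  exact h1.comp_hasDerivAt t h2

theorem Sm.diffT {A : Set ℝ} (hA : IsOpen A) {F : ℝ → ℝ → ℝ} (h : Sm A F) {t : ℝ} (ht : t ∈ A)
    (x : ℝ) : HasDerivAt (fun r => F r x) (deriv (fun r => F r x) t) t :=
  (h.hasT hA ht x).differentiableAt.hasDerivAt

theorem Sm.dt {A : Set ℝ} (hA : IsOpen A) {F : ℝ → ℝ → ℝ} (h : Sm A F) :
    Sm A (fun t x => deriv (fun r => F r x) t) := by
  have h1 : ContDiffOn ℝ (⊤ : ℕ∞) _ _ :=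
    ContDiffOn.fderiv_of_isOpen (m := (⊤ : ℕ∞)) h (hA.prod isOpen_univ) (by simp)
  refine (h1.clm_apply (contDiffOn_const (c := ((1, 0) : ℝ × ℝ)))).congr ?_
  rintro ⟨t, x⟩ ⟨ht, -⟩
  exact (h.hasT hA ht x).deriv

theorem Sm.swap {A : Set ℝ} (hA : IsOpen A) {F : ℝ → ℝ → ℝ} (h : Sm A F) {t : ℝ} (ht : t ∈ A)
    (x : ℝ) : deriv (fun r => deriv (F r) x) t
      = deriv (fun y => deriv (fun r => F r y) t) x := by
  have h22 : (2 : WithTop ℕ∞) ≤ ((⊤ : ℕ∞) : WithTop ℕ∞) :=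
    WithTop.coe_le_coe.2 (le_top : (2 : ℕ∞) ≤ ⊤)
  have hs := (h.at hA ht x).isSymmSndFDerivAt (by simpa using h22) (1, 0) (0, 1)
  have h1 : ContDiffOn ℝ (⊤ : ℕ∞) (fderiv ℝ (fun q : ℝ × ℝ => F q.1 q.2))
      (A ×ˢ (Set.univ : Set ℝ)) :=
    ContDiffOn.fderiv_of_isOpen (m := (⊤ : ℕ∞)) h (hA.prod isOpen_univ) (by simp)
  have h1 : DifferentiableAt ℝ (fderiv ℝ (fun q : ℝ × ℝ => F q.1 q.2)) (t, x) :=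
    (h1.contDiffAt ((hA.prod isOpen_univ).mem_nhds ⟨ht, mem_univ _⟩)).differentiableAt
      (by simp)
  have h6 : (fun r => deriv (F r) x) =ᶠ[nhds t]
      fun r => (fderiv ℝ (fun q : ℝ × ℝ => F q.1 q.2) (r, x)) (0, 1) := by
    filter_upwards [hA.mem_nhds ht] with r hr
    exact (h.hasX' hA hr x).deriv
  have h7 : (fun y => deriv (fun r => F r y) t) =
      fun y => (fderiv ℝ (fun q : ℝ × ℝ => F q.1 q.2) (t, y)) (1, 0) := by
    funext y
    exact (h.hasT hA ht y).deriv
  rw [h6.deriv_eq, h7]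
  generalize fderiv ℝ (fun q : ℝ × ℝ => F q.1 q.2) = D at *
  have h2 : HasDerivAt (fun y : ℝ => ((y, x) : ℝ × ℝ)) (1, 0) t :=
    ((hasDerivAt_id t).prodMk (hasDerivAt_const t x))
  have h3 : HasDerivAt (fun y : ℝ => ((t, y) : ℝ × ℝ)) (0, 1) x :=
    ((hasDerivAt_const x t).prodMk (hasDerivAt_id x))
  have h4 : HasDerivAt (fun r => D (r, x)) (fderiv ℝ D (t, x) (1, 0)) t :=
    h1.hasFDerivAt.comp_hasDerivAt t h2
  have h5 : HasDerivAt (fun y => D (t, y)) (fderiv ℝ D (t, x) (0, 1)) x :=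
    h1.hasFDerivAt.comp_hasDerivAt x h3
  have h4' := (h4.clm_apply (hasDerivAt_const t ((0, 1) : ℝ × ℝ))).deriv
  have h5' := (h5.clm_apply (hasDerivAt_const x ((1, 0) : ℝ × ℝ))).deriv
  rw [h4', h5', map_zero, add_zero, add_zero]
  exact hs

theorem Sm.leib {A : Set ℝ} (hA : IsOpen A) {F : ℝ → ℝ → ℝ} (h : Sm A F) {t : ℝ} (ht : t ∈ A) :
    HasDerivAt (fun r => ∫ x in (0:ℝ)..1, F r x)
      (∫ x in (0:ℝ)..1, deriv (fun r => F r x) t) t := by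
  obtain ⟨e, he, hb⟩ := Metric.nhds_basis_closedBall.mem_iff.1 (hA.mem_nhds ht)
  have hc : ContinuousOn (fun q : ℝ × ℝ => deriv (fun r => F r q.2) q.1)
      (Metric.closedBall t e ×ˢ Icc 0 1) :=
    (h.dt hA).continuousOn.mono (prod_mono hb (subset_univ _))
  obtain ⟨C, hC⟩ := ((isCompact_closedBall t e).prod isCompact_Icc).exists_bound_of_continuousOn hc
  refine (intervalIntegral.hasDerivAt_integral_of_dominated_loc_of_deriv_le
    (F' := fun r x => deriv (fun r => F r x) r) (bound := fun _ => C)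
    (Metric.closedBall_mem_nhds t he) ?_ ?_ ?_ ?_ ?_ ?_).2
  · filter_upwards [hA.mem_nhds ht] with r hr
    exact (h.contX hr).aestronglyMeasurable
  · exact (h.contX ht).intervalIntegrable _ _
  · exact ((h.dt hA).contX ht).aestronglyMeasurable
  · refine Filter.Eventually.of_forall fun x hx r hr => ?_
    rw [uIoc_of_le zero_le_one] at hx
    exact hC (r, x) ⟨hr, hx.1.le, hx.2⟩
  · simp
  · exact Filter.Eventually.of_forall fun x hx r hr => h.diffT hA (hb hr) x

theorem per_deriv {f : ℝ → ℝ} (h : ∀ x, f (x + 1) = f x) (x : ℝ) :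
    deriv f (x + 1) = deriv f x := by
  rw [← deriv_comp_add_const]
  congr 1
  funext y
  exact h y

theorem int_dx {A : Set ℝ} (hA : IsOpen A) {F : ℝ → ℝ → ℝ} (h : Sm A F) {t : ℝ} (ht : t ∈ A)
    (hp : ∀ x, F t (x + 1) = F t x) : ∫ x in (0:ℝ)..1, deriv (F t) x = 0 := by
  rw [intervalIntegral.integral_eq_sub_of_hasDerivAt (fun x _ => h.diffX ht x)
    (((h.dx hA.uniqueDiffOn).contX ht).intervalIntegrable _ _)]
  have := hp 0
  simp only [zero_add] at this
  linarith

theorem lap_bound {T : ℝ} (hT : 0 < T) {V : ℝ → ℝ → ℝ} (hV : Sm (Icc 0 T) V)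
    (hVper : ∀ t x : ℝ, V t (x + 1) = V t x) {t : ℝ} (ht : t ∈ Icc 0 T) (x : ℝ) :
    |deriv (deriv (V t)) x| ≤ lapVsup1 T V := by
  have hU := uniqueDiffOn_Icc hT
  have h2 := (hV.dx hU).dx hU
  have hc : ContinuousOn (fun q : ℝ × ℝ => deriv (deriv (V q.1)) q.2) (Icc 0 T ×ˢ Icc 0 1) :=
    h2.continuousOn.mono (prod_mono subset_rfl (subset_univ _))
  obtain ⟨C, hC⟩ := (isCompact_Icc.prod isCompact_Icc).exists_bound_of_continuousOn hc
  refine le_csSup ⟨C, ?_⟩ ⟨t, ht, x, rfl⟩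
  rintro y ⟨r, hr, z, rfl⟩
  have hp : Function.Periodic (deriv (deriv (V r))) 1 :=
    fun z => per_deriv (per_deriv (hVper r)) z
  obtain ⟨w, hw, hzw⟩ := hp.exists_mem_Ico₀ one_pos z
  rw [hzw]
  exact hC (r, w) ⟨hr, hw.1, hw.2.le⟩

theorem diff_ineq_powers_1d
    (T : ℝ) (hT : 0 < T)
    (V : ℝ → ℝ → ℝ)
    (hV : ContDiffOn ℝ (⊤ : ℕ∞) (fun q : ℝ × ℝ => V q.1 q.2)
      (Set.Icc (0 : ℝ) T ×ˢ (Set.univ : Set ℝ)))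
    (hVper : ∀ t x : ℝ, V t (x + 1) = V t x)
    (g : ℝ → ℝ) (hg : ContDiffOn ℝ (⊤ : ℕ∞) g (Set.Ioi 0)) (hgmono : MonotoneOn g (Set.Ioi 0))
    (m₀ mT : ℝ → ℝ)
    (hm₀sm : ContDiff ℝ (⊤ : ℕ∞) m₀) (hmTsm : ContDiff ℝ (⊤ : ℕ∞) mT)
    (hm₀per : ∀ x : ℝ, m₀ (x + 1) = m₀ x) (hmTper : ∀ x : ℝ, mT (x + 1) = mT x)
    (hm₀nn : ∀ x, 0 ≤ m₀ x) (hmTnn : ∀ x, 0 ≤ mT x)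
    (hm₀pr : ∫ x in Set.Icc (0 : ℝ) 1, m₀ x = 1)
    (hmTpr : ∫ x in Set.Icc (0 : ℝ) 1, mT x = 1)
    (u m : ℝ → ℝ → ℝ)
    (hu : ContDiffOn ℝ (⊤ : ℕ∞) (fun q : ℝ × ℝ => u q.1 q.2)
      (Set.Icc (0 : ℝ) T ×ˢ (Set.univ : Set ℝ)))
    (hm : ContDiffOn ℝ (⊤ : ℕ∞) (fun q : ℝ × ℝ => m q.1 q.2)
      (Set.Icc (0 : ℝ) T ×ˢ (Set.univ : Set ℝ)))
    (huper : ∀ t x : ℝ, u t (x + 1) = u t x)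
    (hmper : ∀ t x : ℝ, m t (x + 1) = m t x)
    (hmnn : ∀ t x, 0 ≤ m t x)
    (hHJ : ∀ t ∈ Set.Ioo (0 : ℝ) T, ∀ x : ℝ,
      -(deriv (fun s => u s x) t) + (deriv (u t) x) ^ 2 / 2 + V t x = g (m t x))
    (hFP : ∀ t ∈ Set.Ioo (0 : ℝ) T, ∀ x : ℝ,
      deriv (fun s => m s x) t = deriv (fun y => m t y * deriv (u t) y) x)
    (hini : ∀ x, m 0 x = m₀ x) (hter : ∀ x, m T x = mT x)
    (hmpos : ∀ t ∈ Set.Icc (0 : ℝ) T, ∀ x : ℝ, 0 < m t x) :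
    ∀ s : ℝ, (s ≤ 0 ∨ 1 ≤ s) → ∀ t ∈ Set.Ioo (0 : ℝ) T,
      deriv (deriv (fun t' => ∫ x in Set.Icc (0 : ℝ) 1, m t' x ^ s)) t ≥
        -|s - 1| * lapVsup1 T V * ∫ x in Set.Icc (0 : ℝ) 1, m t x ^ s := by
  have hA : IsOpen (Ioo (0:ℝ) T) := isOpen_Ioo
  have hU : UniqueDiffOn ℝ (Ioo (0:ℝ) T) := hA.uniqueDiffOn
  have hsub : Ioo (0:ℝ) T ×ˢ (Set.univ : Set ℝ) ⊆ Icc (0:ℝ) T ×ˢ (Set.univ : Set ℝ) :=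
    prod_mono Ioo_subset_Icc_self subset_rfl
  have hVs : Sm (Ioo 0 T) V := hV.mono hsub
  have hus : Sm (Ioo 0 T) u := hu.mono hsub
  have hms : Sm (Ioo 0 T) m := hm.mono hsub
  have hpos : ∀ t ∈ Ioo (0:ℝ) T, ∀ x, 0 < m t x :=
    fun t ht x => hmpos t (Ioo_subset_Icc_self ht) x
  intro s hs
  obtain ⟨P, hP⟩ : ∃ P : ℝ → ℝ → ℝ, P = fun t x => deriv (u t) x := ⟨_, rfl⟩
  have hPs : Sm (Ioo 0 T) P := hP ▸ hus.dx hU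
  have hPxs := hPs.dx hU
  have hPper : ∀ t x, P t (x + 1) = P t x := fun t x => by
    rw [hP]; exact per_deriv (huper t) x
  obtain ⟨G, hG⟩ : ∃ G : ℝ → ℝ → ℝ, G = fun t x => g (m t x) := ⟨_, rfl⟩
  have hGs : Sm (Ioo 0 T) G := by
    rw [hG]
    exact hg.comp hms (fun q hq => hpos q.1 hq.1 q.2)
  have hGxs := hGs.dx hU
  have hGper : ∀ t x, G t (x + 1) = G t x := fun t x => by
    simp only [hG, hmper]
  have hpw : ∀ r : ℝ, Sm (Ioo 0 T) (fun t x => m t x ^ r) := fun r =>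
    ContDiffOn.rpow_const_of_ne hms (fun q hq => (hpos q.1 hq.1 q.2).ne')
  -- pointwise derivatives of powers
  have hpx : ∀ t ∈ Ioo (0:ℝ) T, ∀ x,
      HasDerivAt (fun y => m t y ^ s) (deriv (m t) x * s * m t x ^ (s - 1)) x :=
    fun t ht x => (hms.diffX ht x).rpow_const (Or.inl (hpos t ht x).ne')
  have hpt : ∀ t ∈ Ioo (0:ℝ) T, ∀ x,
      HasDerivAt (fun r => m r x ^ s) (deriv (fun r => m r x) t * s * m t x ^ (s - 1)) t :=
    fun t ht x => (hms.diffT hA ht x).rpow_const (Or.inl (hpos t ht x).ne')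
  have hmul : ∀ t ∈ Ioo (0:ℝ) T, ∀ x, m t x ^ s = m t x ^ (s - 1) * m t x :=
    fun t ht x => by
      rw [← Real.rpow_add_one (hpos t ht x).ne']; congr 1; ring
  have hmt : ∀ t ∈ Ioo (0:ℝ) T, ∀ x,
      deriv (fun r => m r x) t = deriv (m t) x * P t x + m t x * deriv (P t) x := by
    intro t ht x
    rw [hFP t ht x]
    have h1 := (hms.diffX ht x).mul (hPs.diffX ht x)
    have h2 := h1.deriv
    rw [hP] at h2 ⊢
    exact h2
  have hII : ∀ F : ℝ → ℝ, ∫ x in Icc (0:ℝ) 1, F x = ∫ x in (0:ℝ)..1, F x := fun F => by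
    rw [integral_Icc_eq_integral_Ioc, intervalIntegral.integral_of_le zero_le_one]
  -- first derivative
  have hf1 : ∀ t ∈ Ioo (0:ℝ) T, deriv (fun t' => ∫ x in Icc (0:ℝ) 1, m t' x ^ s) t
      = ∫ x in (0:ℝ)..1, (s - 1) * (m t x ^ s * deriv (P t) x) := by
    intro t ht
    simp only [hII]
    rw [((hpw s).leib hA ht).deriv]
    have hQ : Sm (Ioo 0 T) (fun t x => m t x ^ s * P t x) := ContDiffOn.mul (hpw s) hPs
    have hI := int_dx hA hQ ht (fun x => by simp only [hmper, hPper])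
    have hB : Sm (Ioo 0 T) (fun t x => (s - 1) * (m t x ^ s * deriv (P t) x)) :=
      ContDiffOn.mul contDiffOn_const (ContDiffOn.mul (hpw s) hPxs)
    rw [← (add_eq_left (a := ∫ x in (0:ℝ)..1, (s - 1) * (m t x ^ s * deriv (P t) x))).mpr hI,
      ← intervalIntegral.integral_add ((hB.contX ht).intervalIntegrable _ _)
        (((hQ.dx hU).contX ht).intervalIntegrable _ _)]
    congr 1
    funext x
    rw [(hpt t ht x).deriv, ((hpx t ht x).fun_mul (hPs.diffX ht x)).deriv, hmt t ht x,
      hmul t ht x]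
    ring
  intro t ht
  have hB : Sm (Ioo 0 T) (fun t x => (s - 1) * (m t x ^ s * deriv (P t) x)) :=
    ContDiffOn.mul contDiffOn_const (ContDiffOn.mul (hpw s) hPxs)
  have hev : deriv (fun t' => ∫ x in Icc (0:ℝ) 1, m t' x ^ s) =ᶠ[nhds t]
      fun t => ∫ x in (0:ℝ)..1, (s - 1) * (m t x ^ s * deriv (P t) x) := by
    filter_upwards [hA.mem_nhds ht] with r hr
    exact hf1 r hr
  rw [hev.deriv_eq, (hB.leib hA ht).deriv, hII]
  -- equation for P
  have hut : (fun x => deriv (fun r => u r x) t)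
      = fun x => P t x * P t x / 2 + V t x - G t x := by
    funext x
    have := hHJ t ht x
    simp only [hP, hG]
    linarith
  have hPt : (fun x => deriv (fun r => P r x) t)
      = fun x => P t x * deriv (P t) x + deriv (V t) x - deriv (G t) x := by
    funext x
    have h1 : deriv (fun r => P r x) t = deriv (fun y => deriv (fun r => u r y) t) x := by
      rw [hP]; exact hus.swap hA ht x
    rw [h1, hut]
    have h2 := ((((hPs.diffX ht x).fun_mul (hPs.diffX ht x)).div_const 2).fun_add
      (hVs.diffX ht x)).fun_sub (hGs.diffX ht x)
    rw [h2.deriv]; ring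
  have hPxt : ∀ x, deriv (fun r => deriv (P r) x) t
      = deriv (P t) x * deriv (P t) x + P t x * deriv (deriv (P t)) x
        + deriv (deriv (V t)) x - deriv (deriv (G t)) x := by
    intro x
    rw [hPs.swap hA ht x, hPt]
    have h2 := (((hPs.diffX ht x).fun_mul (hPxs.diffX ht x)).fun_add
      ((hVs.dx hU).diffX ht x)).fun_sub (hGxs.diffX ht x)
    exact h2.deriv
  have hQ : Sm (Ioo 0 T) (fun t x =>
      (s - 1) * (m t x ^ s * (P t x * deriv (P t) x - deriv (G t) x))) :=
    ContDiffOn.mul contDiffOn_const (ContDiffOn.mul (hpw s)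
      (ContDiffOn.sub (ContDiffOn.mul hPs hPxs) hGxs))
  have hI := int_dx hA hQ ht (fun x => by
    simp only [hmper, hPper, per_deriv (hPper t), per_deriv (hGper t)])
  have hmI := ((hpw s).contX ht).intervalIntegrable (μ := volume) 0 1
  rw [ge_iff_le, ← intervalIntegral.integral_const_mul,
    ← (add_eq_left (a := ∫ x in (0:ℝ)..1, -|s - 1| * lapVsup1 T V * m t x ^ s)).mpr hI,
    ← intervalIntegral.integral_add (hmI.const_mul _)
        (((hQ.dx hU).contX ht).intervalIntegrable _ _)]
  refine intervalIntegral.integral_mono_on zero_le_one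
    ((hmI.const_mul _).add (((hQ.dx hU).contX ht).intervalIntegrable _ _))
    (((hB.dt hA).contX ht).intervalIntegrable _ _) (fun x _ => ?_)
  have hm0 := hpos t ht x
  have hgd : HasDerivAt g (deriv g (m t x)) (m t x) :=
    ((hg.contDiffAt (Ioi_mem_nhds hm0)).differentiableAt (by simp)).hasDerivAt
  have hg0 : 0 ≤ deriv g (m t x) := by
    rw [← derivWithin_of_isOpen isOpen_Ioi (show m t x ∈ Ioi 0 from hm0)]
    exact hgmono.derivWithin_nonneg
  have hGx : deriv (G t) x = deriv g (m t x) * deriv (m t) x := by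
    rw [hG]
    exact (hgd.comp x (hms.diffX ht x)).deriv
  have e1 := (((hpt t ht x).fun_mul (hPxs.diffT hA ht x)).const_mul (s - 1)).deriv
  have e2 := (((hpx t ht x).fun_mul (((hPs.diffX ht x).fun_mul (hPxs.diffX ht x)).fun_sub
    (hGxs.diffX ht x))).const_mul (s - 1)).deriv
  rw [e1, e2, hPxt x, hmt t ht x, hGx]
  have hL := lap_bound hT hV hVper (Ioo_subset_Icc_self ht) x
  have hr : 0 < m t x ^ (s - 1) := Real.rpow_pos_of_pos hm0 _
  have hss : 0 ≤ s * (s - 1) := by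
    rcases hs with h | h
    · nlinarith
    · nlinarith
  have hk : -(|s - 1| * lapVsup1 T V) ≤ (s - 1) * deriv (deriv (V t)) x := by
    have h1 := neg_abs_le ((s - 1) * deriv (deriv (V t)) x)
    rw [abs_mul] at h1
    have h2 := mul_le_mul_of_nonneg_left hL (abs_nonneg (s - 1))
    linarith
  rw [hmul t ht x]
  have k1 := mul_le_mul_of_nonneg_right hk (mul_pos hr hm0).le
  have k2 : 0 ≤ s * (s - 1) * (m t x ^ (s - 1) * m t x) * (deriv (P t) x * deriv (P t) x) :=
    mul_nonneg (mul_nonneg hss (mul_pos hr hm0).le) (mul_self_nonneg _)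
  have k3 : 0 ≤ s * (s - 1) * m t x ^ (s - 1) * deriv g (m t x)
      * (deriv (m t) x * deriv (m t) x) :=
    mul_nonneg (mul_nonneg (mul_nonneg hss hr.le) hg0) (mul_self_nonneg _)
  linarith
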